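/- Let 1 ≤ p < ∞, let f ∈ U_p(ℝ²), and for h > 0 set f_h(x,y) = h^{−2} ∫₀^h ∫₀^h f(x+u, y+v) du dv. Then for every y ∈ ℝ the section f_h(·, y) and for every x ∈ ℝ the section f_h(x, ·) satisfy ‖f_h(·,y)‖*_{Lip 1/p} ≤ φ₁**(h) and ‖f_h(x,·)‖*_{Lip 1/p} ≤ φ₂**(h), where φ₁(y) = ‖f_y‖*_{Lip 1/p}, φ₂(x) = ‖f_x‖*_{Lip 1/p}, and φ**(t) = (1/t)∫₀^t φ*(u) du. -/

import Mathlib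

open MeasureTheory Set
open scoped ENNReal

noncomputable section

/-- Extended essential sup norm on ℝ. -/
def einf (φ : ℝ → ℝ) : ℝ≥0∞ := eLpNorm φ ⊤ volume

/-- Lipschitz `α` seminorm (extended real valued):
`sup_{h>0} h^{-α} ‖φ(·+h) - φ‖_∞`. -/
def lipSemiE (α : ℝ) (φ : ℝ → ℝ) : ℝ≥0∞ :=
  ⨆ h ∈ Ioi (0:ℝ), ENNReal.ofReal (h ^ (-α)) * einf (fun x => φ (x + h) - φ x)

/-- Real-valued Lipschitz `α` seminorm `‖φ‖*_{Lip α}`. -/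
def lipSemi (α : ℝ) (φ : ℝ → ℝ) : ℝ := (lipSemiE α φ).toReal

/-- `φ ∈ Lip α`: essentially bounded with finite Lipschitz `α` seminorm. -/
def MemLip (α : ℝ) (φ : ℝ → ℝ) : Prop := einf φ < ⊤ ∧ lipSemiE α φ < ⊤

/-- `‖φ‖_{Lip α} = ‖φ‖_∞ + ‖φ‖*_{Lip α}`. -/
def lipNorm (α : ℝ) (φ : ℝ → ℝ) : ℝ := (einf φ + lipSemiE α φ).toReal

/-- The class `S₀`: measurable functions with finite distribution function at every
positive level. -/
def S0 {X : Type*} [MeasureSpace X] (f : X → ℝ) : Prop :=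
  Measurable f ∧ ∀ s : ℝ, 0 < s → volume {x | s < |f x|} < ⊤

/-- The non-increasing rearrangement `f*`. -/
def rearr {X : Type*} [MeasureSpace X] (f : X → ℝ) (t : ℝ) : ℝ :=
  sInf {s : ℝ | 0 ≤ s ∧ volume {x | s < |f x|} ≤ ENNReal.ofReal t}

/-- `f**(t) = (1/t) ∫₀^t f*(u) du`. -/
def doubleStar {X : Type*} [MeasureSpace X] (f : X → ℝ) (t : ℝ) : ℝ :=
  (∫ u in Ioc (0:ℝ) t, rearr f u) / t

/-- Lorentz `L^{p,q}` norm. -/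
def lorentzNorm {X : Type*} [MeasureSpace X] (p q : ℝ) (f : X → ℝ) : ℝ :=
  (∫ t in Ioi (0:ℝ), (t ^ (1/p) * rearr f t) ^ q / t) ^ (1/q)

/-- Membership in the Lorentz space `L^{p,q}`. -/
def MemLorentz {X : Type*} [MeasureSpace X] (p q : ℝ) (f : X → ℝ) : Prop :=
  S0 f ∧ IntegrableOn (fun t => (t ^ (1/p) * rearr f t) ^ q / t) (Ioi (0:ℝ))

/-- The space `U_p(ℝ²)`: a.e. sections in `Lip (1/p)`, with `Lip (1/p)` norms of the
sections in `L^{p,1}(ℝ)`. -/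
def MemUp (p : ℝ) (f : ℝ × ℝ → ℝ) : Prop :=
  Measurable f ∧
  (∀ᵐ y : ℝ ∂volume, MemLip (1/p) (fun x => f (x, y))) ∧
  (∀ᵐ x : ℝ ∂volume, MemLip (1/p) (fun y => f (x, y))) ∧
  MemLorentz p 1 (fun y => lipNorm (1/p) (fun x => f (x, y))) ∧
  MemLorentz p 1 (fun x => lipNorm (1/p) (fun y => f (x, y)))

/-- The Steklov-type average `f_h`. -/
def avg (f : ℝ × ℝ → ℝ) (h : ℝ) (z : ℝ × ℝ) : ℝ :=
  (∫ u in Ioc (0:ℝ) h, ∫ v in Ioc (0:ℝ) h, f (z.1 + u, z.2 + v)) / h ^ 2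

/-- The levels whose infimum is the non-increasing rearrangement at `t`. -/
def rearrLevels {X : Type*} [MeasureSpace X] (f : X → ℝ) (t : ℝ) : Set ℝ :=
  {s : ℝ | 0 ≤ s ∧ volume {x | s < |f x|} ≤ ENNReal.ofReal t}

section Rearrangement

variable {X : Type*} [MeasureSpace X] {f g : X → ℝ}

lemma bddBelow_rearrLevels (f : X → ℝ) (t : ℝ) : BddBelow (rearrLevels f t) :=
  ⟨0, fun _ hs => hs.1⟩

lemma rearr_nonneg (f : X → ℝ) (t : ℝ) : 0 ≤ rearr f t :=
  Real.sInf_nonneg fun _ hs => hs.1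

lemma rearrLevels_subset_of_ae_le (hfg : ∀ᵐ x, |f x| ≤ |g x|) (t : ℝ) :
    rearrLevels g t ⊆ rearrLevels f t := fun s hs =>
  ⟨hs.1, (measure_mono_ae (by
    filter_upwards [hfg] with x hx hsx using lt_of_lt_of_le hsx hx)).trans hs.2⟩

lemma rearr_le_of_ae_le (hfg : ∀ᵐ x, |f x| ≤ |g x|) {t : ℝ} (hg : (rearrLevels g t).Nonempty) :
    rearr f t ≤ rearr g t :=
  csInf_le_csInf (bddBelow_rearrLevels f t) hg (rearrLevels_subset_of_ae_le hfg t)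

lemma rearr_antitoneOn (hf : ∀ t, 0 < t → (rearrLevels f t).Nonempty) :
    AntitoneOn (rearr f) (Ioi 0) := fun s hs t _ hst =>
  csInf_le_csInf (bddBelow_rearrLevels f t) (hf s hs)
    fun _ hr => ⟨hr.1, hr.2.trans (ENNReal.ofReal_le_ofReal hst)⟩

lemma aemeasurable_rearr (hf : ∀ t, 0 < t → (rearrLevels f t).Nonempty) (h : ℝ) :
    AEMeasurable (rearr f) (volume.restrict (Ioc 0 h)) :=
  aemeasurable_restrict_of_antitoneOn measurableSet_Ioc
    ((rearr_antitoneOn hf).mono Ioc_subset_Ioi_self)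

lemma S0.rearrLevels_nonempty (hf : S0 f) {t : ℝ} (ht : 0 < t) :
    (rearrLevels f t).Nonempty := by
  have hlim : Filter.Tendsto (fun n : ℕ => volume {x | (n : ℝ) + 1 < |f x|}) Filter.atTop
      (nhds (volume (⋂ n : ℕ, {x | (n : ℝ) + 1 < |f x|}))) := by
    refine tendsto_measure_iInter_atTop
      (fun n => (measurableSet_lt measurable_const hf.1.abs).nullMeasurableSet) ?_
      ⟨0, (hf.2 _ (by positivity)).ne⟩
    intro m n hmn x hx
    have : (m : ℝ) ≤ n := by exact_mod_cast hmn
    simp only [mem_ofPred_eq] at hx ⊢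
    linarith
  have hempty : (⋂ n : ℕ, {x | (n : ℝ) + 1 < |f x|}) = ∅ := by
    refine eq_empty_of_forall_notMem fun x hx => ?_
    obtain ⟨n, hn⟩ := exists_nat_gt |f x|
    have := mem_iInter.1 hx n
    simp only [mem_ofPred_eq] at this
    linarith
  rw [hempty, measure_empty] at hlim
  obtain ⟨n, hn⟩ := (hlim.eventually (gt_mem_nhds (ENNReal.ofReal_pos.2 ht))).exists
  exact ⟨n + 1, by positivity, hn.le⟩

lemma rearr_comp_add_left (F : ℝ → ℝ) (y : ℝ) :
    rearr (fun v => F (y + v)) = rearr F := by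
  funext t
  have (s : ℝ) : volume {v | s < |F (y + v)|} = volume {v | s < |F v|} :=
    measure_preimage_add volume y {v | s < |F v|}
  simp only [rearr, this]

lemma rearrLevels_comp_add_left (F : ℝ → ℝ) (y t : ℝ) :
    rearrLevels (fun v => F (y + v)) t = rearrLevels F t := by
  have (s : ℝ) : volume {v | s < |F (y + v)|} = volume {v | s < |F v|} :=
    measure_preimage_add volume y {v | s < |F v|}
  simp only [rearrLevels, this]

/-- The Hardy–Littlewood inequality on an interval of length `h`, for a measurable minorant
of a function which need not be measurable. -/
lemma lintegral_le_lintegral_rearr {G : ℝ → ℝ≥0∞} {F : ℝ → ℝ} {h : ℝ}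
    (hG : Measurable G) (hGF : ∀ᵐ v, G v ≤ ENNReal.ofReal |F v|)
    (hF : ∀ t, 0 < t → (rearrLevels F t).Nonempty) :
    ∫⁻ v in Ioc 0 h, G v ≤ ∫⁻ u in Ioc 0 h, ENNReal.ofReal (rearr F u) := by
  have hGr : ∫⁻ v in Ioc 0 h, G v = ∫⁻ v in Ioc 0 h, ENNReal.ofReal (G v).toReal := by
    refine lintegral_congr_ae (ae_restrict_of_ae ?_)
    filter_upwards [hGF] with v hv
    rw [ENNReal.ofReal_toReal (hv.trans_lt ENNReal.ofReal_lt_top).ne]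
  rw [hGr, lintegral_eq_lintegral_meas_lt _ (Filter.Eventually.of_forall fun _ =>
      ENNReal.toReal_nonneg) hG.ennreal_toReal.aemeasurable,
    lintegral_eq_lintegral_meas_le _ (Filter.Eventually.of_forall fun u => rearr_nonneg F u)
      (aemeasurable_rearr hF h)]
  refine setLIntegral_mono' measurableSet_Ioi fun t ht => ?_
  set d := volume {v | t < |F v|} with hd
  have hleft : (volume.restrict (Ioc 0 h)) {v | t < (G v).toReal} ≤
      min (ENNReal.ofReal h) d := by
    refine le_min ((measure_mono (subset_univ _)).trans (by simp)) ?_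
    refine (Measure.restrict_apply_le _ _).trans (measure_mono_ae ?_)
    filter_upwards [hGF] with v hv htv
    exact lt_of_lt_of_le htv (ENNReal.toReal_le_of_le_ofReal (abs_nonneg _) hv)
  have hlevel (u : ℝ) (hu : 0 < u) (hud : ENNReal.ofReal u < d) : t ≤ rearr F u := by
    refine le_csInf (hF u hu) fun s hs => ?_
    by_contra! hst
    have : d ≤ ENNReal.ofReal u :=
      (measure_mono fun v (hv : t < |F v|) => hst.trans hv).trans hs.2
    exact this.not_gt hud
  refine hleft.trans ?_
  rw [Measure.restrict_apply' measurableSet_Ioc]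
  by_cases hdt : d = ⊤
  · rw [hdt, min_eq_left le_top]
    calc ENNReal.ofReal h = volume (Ioc 0 h) := by simp
      _ ≤ volume ({u | t ≤ rearr F u} ∩ Ioc 0 h) := measure_mono fun u hu =>
        ⟨hlevel u hu.1 (hdt ▸ ENNReal.ofReal_lt_top), hu⟩
  · calc min (ENNReal.ofReal h) d = volume (Ioo 0 (min h d.toReal)) := by
          rw [Real.volume_Ioo, sub_zero, ENNReal.ofReal_min, ENNReal.ofReal_toReal hdt]
      _ ≤ volume ({u | t ≤ rearr F u} ∩ Ioc 0 h) := measure_mono fun u hu => by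
        have := lt_min_iff.1 hu.2
        exact ⟨hlevel u hu.1 ((ENNReal.ofReal_lt_iff_lt_toReal hu.1.le hdt).2 this.2),
          hu.1, this.1.le⟩

lemma MemLorentz.integrableOn_rearr {p : ℝ} (hp : 1 ≤ p) (hf : MemLorentz p 1 f)
    (h : ℝ) : IntegrableOn (rearr f) (Ioc 0 h) := by
  have hne := fun t (ht : 0 < t) => hf.1.rearrLevels_nonempty ht
  have hint := (hf.2.mono_set (Ioc_subset_Ioi_self : Ioc 0 h ⊆ Ioi 0)).const_mul
    (h ^ (1 - 1 / p))
  refine Integrable.mono' hint (aemeasurable_rearr hne h).aestronglyMeasurable ?_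
  refine (ae_restrict_mem measurableSet_Ioc).mono fun t ht => ?_
  have ht0 : 0 < t := ht.1
  have hp' : 1 / p ≤ 1 := by rw [div_le_one (by linarith)]; exact hp
  have hpow : t ^ (1 - 1 / p) ≤ h ^ (1 - 1 / p) :=
    Real.rpow_le_rpow ht0.le ht.2 (by linarith)
  have hmul : t ^ (1 - 1 / p) * (t ^ (1 / p) / t) = 1 := by
    rw [← mul_div_assoc, ← Real.rpow_add ht0]
    simp [ht0.ne']
  have hr := rearr_nonneg f t
  rw [Real.norm_of_nonneg hr, Real.rpow_one]
  calc rearr f t = (t ^ (1 - 1 / p) * (t ^ (1 / p) / t)) * rearr f t := by rw [hmul, one_mul]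
    _ ≤ (h ^ (1 - 1 / p) * (t ^ (1 / p) / t)) * rearr f t := by gcongr
    _ = h ^ (1 - 1 / p) * (t ^ (1 / p) * rearr f t / t) := by ring

end Rearrangement

lemma einf_le_lipNorm {α : ℝ} {φ : ℝ → ℝ} (hφ : MemLip α φ) :
    einf φ ≤ ENNReal.ofReal (lipNorm α φ) := by
  rw [lipNorm, ENNReal.ofReal_toReal (ENNReal.add_lt_top.2 hφ).ne]
  exact le_self_add

lemma lipSemi_le_lipNorm {α : ℝ} {φ : ℝ → ℝ} (hφ : MemLip α φ) :
    lipSemi α φ ≤ lipNorm α φ :=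
  ENNReal.toReal_mono (ENNReal.add_lt_top.2 hφ).ne le_add_self

lemma ae_enorm_le_einf (φ : ℝ → ℝ) : ∀ᵐ x, ‖φ x‖ₑ ≤ einf φ := by
  simpa [einf, eLpNorm_exponent_top] using enorm_ae_le_eLpNormEssSup φ volume

lemma ae_enorm_increment_le_lipSemi {α : ℝ} {φ : ℝ → ℝ} (hφ : MemLip α φ) {k : ℝ} (hk : 0 < k) :
    ∀ᵐ x, ‖k ^ (-α) * (φ (x + k) - φ x)‖ₑ ≤ ENNReal.ofReal (lipSemi α φ) := by
  filter_upwards [ae_enorm_le_einf fun x => φ (x + k) - φ x] with x hx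
  rw [lipSemi, ENNReal.ofReal_toReal hφ.2.ne, enorm_mul,
    Real.enorm_of_nonneg (Real.rpow_nonneg hk.le _)]
  exact (mul_le_mul_right hx _).trans
    (le_iSup₂ (f := fun h (_ : h ∈ Ioi (0 : ℝ)) =>
      ENNReal.ofReal (h ^ (-α)) * einf (fun x => φ (x + h) - φ x)) k hk)

/-- Integral over a translated square, controlled by the rearrangement of a bound which
is uniform on almost every horizontal section. -/
lemma lintegral_square_le {g : ℝ × ℝ → ℝ} (hg : Measurable g) {F : ℝ → ℝ}
    (hgF : ∀ᵐ y, ∀ᵐ x, ‖g (x, y)‖ₑ ≤ ENNReal.ofReal |F y|)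
    (hF : ∀ t, 0 < t → (rearrLevels F t).Nonempty) {h : ℝ} (hh : 0 < h) (x y : ℝ) :
    ∫⁻ z, ‖g (x + z.1, y + z.2)‖ₑ
        ∂((volume.restrict (Ioc 0 h)).prod (volume.restrict (Ioc 0 h))) ≤
      ENNReal.ofReal h * ∫⁻ u in Ioc 0 h, ENNReal.ofReal (rearr F u) := by
  have hmeas : Measurable fun z : ℝ × ℝ => ‖g (x + z.1, y + z.2)‖ₑ := by fun_prop
  have h0 : ENNReal.ofReal h ≠ 0 := (ENNReal.ofReal_pos.2 hh).ne'
  have hle := lintegral_le_lintegral_rearr (h := h) (F := fun v => F (y + v))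
    (G := fun v => (ENNReal.ofReal h)⁻¹ * ∫⁻ u in Ioc 0 h, ‖g (x + u, y + v)‖ₑ)
    (hmeas.lintegral_prod_left'.const_mul _) ?_
    (fun t ht => by rw [rearrLevels_comp_add_left]; exact hF t ht)
  · rw [rearr_comp_add_left, lintegral_const_mul _ hmeas.lintegral_prod_left'] at hle
    rw [lintegral_prod_symm' _ hmeas]
    exact (ENNReal.inv_mul_le_iff h0 ENNReal.ofReal_ne_top).1 hle
  · have hy := (measurePreserving_add_left volume y).quasiMeasurePreserving.ae hgF
    filter_upwards [hy] with v hv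
    have hx := (measurePreserving_add_left volume x).quasiMeasurePreserving.ae hv
    rw [ENNReal.inv_mul_le_iff h0 ENNReal.ofReal_ne_top]
    calc ∫⁻ u in Ioc 0 h, ‖g (x + u, y + v)‖ₑ
        ≤ ∫⁻ _ in Ioc 0 h, ENNReal.ofReal |F (y + v)| :=
          lintegral_mono_ae (ae_restrict_of_ae hx)
      _ = ENNReal.ofReal h * ENNReal.ofReal |F (y + v)| := by simp [mul_comm]

section Average

variable {p : ℝ} {f : ℝ × ℝ → ℝ} {h : ℝ}

lemma integrable_square (hp : 1 ≤ p) (hf : Measurable f)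
    (hlip : ∀ᵐ y : ℝ, MemLip (1 / p) fun x => f (x, y))
    (hN : MemLorentz p 1 fun y => lipNorm (1 / p) fun x => f (x, y)) (hh : 0 < h) (x y : ℝ) :
    Integrable (fun z : ℝ × ℝ => f (x + z.1, y + z.2))
      ((volume.restrict (Ioc 0 h)).prod (volume.restrict (Ioc 0 h))) := by
  refine ⟨(by fun_prop : Measurable fun z : ℝ × ℝ =>
    f (x + z.1, y + z.2)).aestronglyMeasurable, ?_⟩
  have hle := lintegral_square_le hf (F := fun y => lipNorm (1 / p) fun x => f (x, y)) ?_
    (fun t ht => hN.1.rearrLevels_nonempty ht) hh x y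
  · refine hle.trans_lt (ENNReal.mul_lt_top ENNReal.ofReal_lt_top ?_)
    rw [← ofReal_integral_eq_lintegral_ofReal (hN.integrableOn_rearr hp h)
      (Filter.Eventually.of_forall fun u => rearr_nonneg _ u)]
    exact ENNReal.ofReal_lt_top
  · filter_upwards [hlip] with y hy
    filter_upwards [ae_enorm_le_einf fun x => f (x, y)] with x hx
    exact hx.trans ((einf_le_lipNorm hy).trans (ENNReal.ofReal_le_ofReal (le_abs_self _)))

lemma lipSemiE_avg_le (hp : 1 ≤ p) (hf : Measurable f)
    (hlip : ∀ᵐ y : ℝ, MemLip (1 / p) fun x => f (x, y))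
    (hN : MemLorentz p 1 fun y => lipNorm (1 / p) fun x => f (x, y)) (hh : 0 < h) (y : ℝ) :
    lipSemiE (1 / p) (fun x => avg f h (x, y)) ≤
      ENNReal.ofReal (doubleStar (fun y' => lipSemi (1 / p) fun x' => f (x', y')) h) := by
  set μ := (volume.restrict (Ioc (0 : ℝ) h)).prod (volume.restrict (Ioc (0 : ℝ) h)) with hμ
  set F : ℝ → ℝ := fun y' => lipSemi (1 / p) fun x' => f (x', y') with hFdef
  have hF0 (v : ℝ) : 0 ≤ F v := ENNReal.toReal_nonneg
  have hFN : ∀ᵐ v, |F v| ≤ |lipNorm (1 / p) fun x => f (x, v)| := by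
    filter_upwards [hlip] with v hv
    rw [abs_of_nonneg (hF0 v)]
    exact (lipSemi_le_lipNorm hv).trans (le_abs_self _)
  have hFne (t : ℝ) (ht : 0 < t) : (rearrLevels F t).Nonempty :=
    (hN.1.rearrLevels_nonempty ht).mono (rearrLevels_subset_of_ae_le hFN t)
  have hFint : IntegrableOn (rearr F) (Ioc 0 h) := by
    refine Integrable.mono' (hN.integrableOn_rearr hp h)
      (aemeasurable_rearr hFne h).aestronglyMeasurable
      ((ae_restrict_mem measurableSet_Ioc).mono fun t ht => ?_)
    rw [Real.norm_of_nonneg (rearr_nonneg F t)]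
    exact rearr_le_of_ae_le hFN (hN.1.rearrLevels_nonempty ht.1)
  have hint (x : ℝ) : Integrable (fun z : ℝ × ℝ => f (x + z.1, y + z.2)) μ :=
    integrable_square hp hf hlip hN hh x y
  have havg (x : ℝ) : avg f h (x, y) = (∫ z, f (x + z.1, y + z.2) ∂μ) / h ^ 2 := by
    rw [avg, integral_prod _ (hint x)]
  refine iSup₂_le fun k hk => ?_
  have hk : 0 < k := hk
  have hg : Measurable fun z : ℝ × ℝ => k ^ (-(1 / p)) * (f (z.1 + k, z.2) - f z) := by fun_prop
  have hbound : ∀ᵐ v, ∀ᵐ x, ‖k ^ (-(1 / p)) * (f (x + k, v) - f (x, v))‖ₑ ≤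
      ENNReal.ofReal |F v| := by
    filter_upwards [hlip] with v hv
    rw [abs_of_nonneg (hF0 v)]
    exact ae_enorm_increment_le_lipSemi hv hk
  have hpoint (x : ℝ) : ENNReal.ofReal (k ^ (-(1 / p))) *
      ‖avg f h (x + k, y) - avg f h (x, y)‖ₑ ≤ ENNReal.ofReal (doubleStar F h) := by
    have heq : k ^ (-(1 / p)) * (avg f h (x + k, y) - avg f h (x, y)) =
        (∫ z, k ^ (-(1 / p)) * (f (x + z.1 + k, y + z.2) - f (x + z.1, y + z.2)) ∂μ) / h ^ 2 := by
      have hshift (z : ℝ × ℝ) : f (x + z.1 + k, y + z.2) = f (x + k + z.1, y + z.2) := by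
        rw [add_right_comm]
      simp only [hshift]
      rw [havg, havg, integral_const_mul, integral_sub (hint _) (hint _)]
      ring
    have hle := (enorm_integral_le_lintegral_enorm (μ := μ) fun z : ℝ × ℝ =>
      k ^ (-(1 / p)) * (f (x + z.1 + k, y + z.2) - f (x + z.1, y + z.2))).trans
      (lintegral_square_le hg hbound hFne hh x y)
    rw [← ofReal_integral_eq_lintegral_ofReal hFint
      (Filter.Eventually.of_forall fun u => rearr_nonneg _ u), ← ENNReal.ofReal_mul hh.le] at hle
    have hI : 0 ≤ ∫ u in Ioc 0 h, rearr F u := integral_nonneg fun u => rearr_nonneg F u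
    rw [← Real.enorm_of_nonneg (Real.rpow_nonneg hk.le _), ← enorm_mul, heq]
    rw [Real.enorm_eq_ofReal_abs, ENNReal.ofReal_le_ofReal_iff (by positivity)] at hle
    rw [Real.enorm_eq_ofReal_abs]
    refine ENNReal.ofReal_le_ofReal ?_
    rw [abs_div, abs_of_pos (by positivity : 0 < h ^ 2), doubleStar, div_le_div_iff₀
      (by positivity) hh]
    nlinarith [mul_le_mul_of_nonneg_right hle hh.le]
  have h0 : ENNReal.ofReal (k ^ (-(1 / p))) ≠ 0 :=
    (ENNReal.ofReal_pos.2 (Real.rpow_pos_of_pos hk _)).ne'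
  rw [mul_comm, ← ENNReal.le_div_iff_mul_le (Or.inl h0) (Or.inl ENNReal.ofReal_ne_top), einf,
    eLpNorm_exponent_top]
  refine essSup_le_of_ae_le _ (Filter.Eventually.of_forall fun x => ?_)
  rw [ENNReal.le_div_iff_mul_le (Or.inl h0) (Or.inl ENNReal.ofReal_ne_top), mul_comm]
  exact hpoint x

lemma avg_swap (hp : 1 ≤ p) (hf : Measurable f)
    (hlip : ∀ᵐ y : ℝ, MemLip (1 / p) fun x => f (x, y))
    (hN : MemLorentz p 1 fun y => lipNorm (1 / p) fun x => f (x, y)) (hh : 0 < h) (x y : ℝ) :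
    avg f h (x, y) = avg (fun z => f (z.2, z.1)) h (y, x) := by
  simp only [avg]
  rw [integral_integral_swap (integrable_square hp hf hlip hN hh x y)]

end Average

/-- If `1 ≤ p < ∞`, `f ∈ U_p(ℝ²)`, `h > 0`, then every section of
the Steklov average `f_h` satisfies `‖f_h(·,y)‖*_{Lip 1/p} ≤ φ₁**(h)` and
`‖f_h(x,·)‖*_{Lip 1/p} ≤ φ₂**(h)`. -/
theorem stmt9 (p : ℝ) (hp : 1 ≤ p) (f : ℝ × ℝ → ℝ) (hf : MemUp p f)
    (h : ℝ) (hh : 0 < h) :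
    (∀ y : ℝ, lipSemiE (1/p) (fun x => avg f h (x, y)) ≤
      ENNReal.ofReal (doubleStar (fun y' => lipSemi (1/p) (fun x' => f (x', y'))) h)) ∧
    (∀ x : ℝ, lipSemiE (1/p) (fun y => avg f h (x, y)) ≤
      ENNReal.ofReal (doubleStar (fun x' => lipSemi (1/p) (fun y' => f (x', y'))) h)) := by
  obtain ⟨hm, hlip₁, hlip₂, hN₁, hN₂⟩ := hf
  refine ⟨lipSemiE_avg_le hp hm hlip₁ hN₁ hh, fun x => ?_⟩
  simp only [avg_swap hp hm hlip₁ hN₁ hh]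
  exact lipSemiE_avg_le (f := fun z => f (z.2, z.1)) hp (by fun_prop) hlip₂ hN₂ hh x

end
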